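/- If h ∈ H lies in the kernel N of the natural map H → V onto the Klein four-group but h does not lie in the subgroup of H generated by x, y, and t, then ℓ(h) ≥ |ε(h)| + 4. -/

import Mathlib

/-! Generators and presentations for the groups `H` and `G` of Neumann–Shapiro. -/

inductive GenH : Type
  | x | y | t | tau
  deriving DecidableEq

inductive GenG : Type
  | x | y | s | t
  deriving DecidableEq

namespace NS

open FreeGroup

/-- Conjugation `a^b = b⁻¹ a b` in a group. -/
def cnj {Γ : Type*} [Group Γ] (a b : Γ) : Γ := b⁻¹ * a * b

/-! ### The group `H` -/

abbrev FH := FreeGroup GenH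

def fx : FH := FreeGroup.of GenH.x
def fy : FH := FreeGroup.of GenH.y
def ft : FH := FreeGroup.of GenH.t
def ftau : FH := FreeGroup.of GenH.tau

/-- The eight elements `x, x^t, x^τ, x^{tτ}, y, y^t, y^τ, y^{tτ}` (as words). -/
def basisH : List FH :=
  [fx, cnj fx ft, cnj fx ftau, cnj fx (ft * ftau),
   fy, cnj fy ft, cnj fy ftau, cnj fy (ft * ftau)]

/-- Relators of `H`: `t² = τ² = [τ,t] = 1`, the eight elements of `basisH` pairwise
commute, and `x · x^τ = y · y^t`. -/
def relsH : Set FH :=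
  {ft ^ 2, ftau ^ 2, ftau⁻¹ * ft⁻¹ * ftau * ft} ∪
    {r | ∃ a ∈ basisH, ∃ b ∈ basisH, r = a * b * a⁻¹ * b⁻¹} ∪
    {fx * cnj fx ftau * (fy * cnj fy ft)⁻¹}

abbrev H := PresentedGroup relsH

def Hx : H := PresentedGroup.of GenH.x
def Hy : H := PresentedGroup.of GenH.y
def Ht : H := PresentedGroup.of GenH.t
def Htau : H := PresentedGroup.of GenH.tau

/-! ### The group `G` -/

abbrev FG := FreeGroup GenG

def gx : FG := FreeGroup.of GenG.x
def gy : FG := FreeGroup.of GenG.y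
def gs : FG := FreeGroup.of GenG.s
def gt : FG := FreeGroup.of GenG.t

/-- The eight conjugating elements `1, s, s², s³, t, ts, ts², ts³`. -/
def conjsG : List FG := [1, gs, gs ^ 2, gs ^ 3, gt, gt * gs, gt * gs ^ 2, gt * gs ^ 3]

/-- The sixteen elements `x^α, y^α` for `α ∈ {1, s, s², s³, t, ts, ts², ts³}`. -/
def basisG : List FG :=
  conjsG.map (fun b => cnj gx b) ++ conjsG.map (fun b => cnj gy b)

/-- Relators of `G`: `t² = s⁴ = [s,t] = 1`, the sixteen elements of `basisG` pairwise
commute, and `x · x^{s²} = y · y^t`. -/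
def relsG : Set FG :=
  {gt ^ 2, gs ^ 4, gs⁻¹ * gt⁻¹ * gs * gt} ∪
    {r | ∃ a ∈ basisG, ∃ b ∈ basisG, r = a * b * a⁻¹ * b⁻¹} ∪
    {gx * cnj gx (gs ^ 2) * (gy * cnj gy gt)⁻¹}

abbrev G := PresentedGroup relsG

def Gx : G := PresentedGroup.of GenG.x
def Gy : G := PresentedGroup.of GenG.y
def Gs : G := PresentedGroup.of GenG.s
def Gt : G := PresentedGroup.of GenG.t

/-! ### Words, evaluation, lengths, geodesics -/

/-- A word over the symmetric alphabet on `α`: a letter `(a, true)` stands for the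
generator `a` and `(a, false)` for its inverse. -/
abbrev Word (α : Type) := List (α × Bool)

/-- Evaluate a word in a group, given the images of the generators. -/
def evalWith {α : Type} {Γ : Type*} [Group Γ] (f : α → Γ) (w : Word α) : Γ :=
  (w.map fun p => if p.2 then f p.1 else (f p.1)⁻¹).prod

/-- Evaluation of a word over `X_H = {x^{±1}, y^{±1}, t^{±1}, τ^{±1}}` in `H`. -/
def evalH : Word GenH → H := evalWith (fun a => (PresentedGroup.of a : H))

/-- Evaluation of a word over `X = {x^{±1}, y^{±1}, t^{±1}, s^{±1}}` in `G`. -/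
def evalG : Word GenG → G := evalWith (fun a => (PresentedGroup.of a : G))

/-- Weight of a letter for `H`: the letters `x^{±1}, y^{±1}, t^{±1}` have length `1`
and `τ^{±1}` has length `2`. -/
def wtH : GenH × Bool → ℕ
  | (GenH.tau, _) => 2
  | _ => 1

/-- Weighted length of a word over `X_H`. -/
def wlenH (w : Word GenH) : ℕ := (w.map wtH).sum

/-- `ℓ(h)`: the minimum weighted length of a word over `X_H` evaluating to `h`. -/
noncomputable def ellH (h : H) : ℕ := sInf {n | ∃ w : Word GenH, evalH w = h ∧ wlenH w = n}

/-- A word over `X_H` is geodesic if its weighted length is `ℓ` of its evaluation. -/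
def IsGeodesicH (w : Word GenH) : Prop := wlenH w = ellH (evalH w)

/-- `ℓ_G(g)`: the minimum length (number of letters) of a word over `X` evaluating to `g`. -/
noncomputable def ellG (g : G) : ℕ := sInf {n | ∃ w : Word GenG, evalG w = g ∧ w.length = n}

/-- A word over `X` is geodesic if its length is `ℓ_G` of its evaluation. -/
def IsGeodesicG (w : Word GenG) : Prop := w.length = ellG (evalG w)

end NS

namespace NS

/-- The Klein four-group. -/
abbrev V := Multiplicative (ZMod 2 × ZMod 2)

/-- The first generator of the Klein four-group (image of `t`). -/
def vt : V := Multiplicative.ofAdd (1, 0)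

/-- The second generator of the Klein four-group (image of `τ`). -/
def vtau : V := Multiplicative.ofAdd (0, 1)

end NS

namespace NS

theorem evalWith_nil {α : Type} {Γ : Type*} [Group Γ] (f : α → Γ) : evalWith f [] = 1 := rfl

theorem evalWith_cons {α : Type} {Γ : Type*} [Group Γ] (f : α → Γ) (p : α × Bool) (w : Word α) :
    evalWith f (p :: w) = (if p.2 then f p.1 else (f p.1)⁻¹) * evalWith f w := by
  simp [evalWith]

theorem evalH_surjective : Function.Surjective evalH := by
  intro h
  obtain ⟨f, rfl⟩ := PresentedGroup.mk_surjective relsH h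
  obtain ⟨w, rfl⟩ : ∃ w, FreeGroup.mk w = f := Quot.exists_rep f
  refine ⟨w, ?_⟩
  induction w with
  | nil => rfl
  | cons p w ih =>
    have hw : FreeGroup.mk (p :: w)
        = FreeGroup.mk [p] * FreeGroup.mk w := rfl
    rw [evalH, evalWith_cons, ← evalH, ih, hw, map_mul]
    congr 1
    obtain ⟨a, _ | _⟩ := p <;> rfl

theorem exists_word_wlenH_eq_ellH (h : H) : ∃ w, evalH w = h ∧ wlenH w = ellH h :=
  have ⟨w, hw⟩ := evalH_surjective h
  Nat.sInf_mem (s := {n | ∃ w : Word GenH, evalH w = h ∧ wlenH w = n}) ⟨_, w, hw, rfl⟩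

/-- The number of letters `τ^{±1}` in a word. -/
def tauCount (w : Word GenH) : ℕ := w.countP fun p => p.1 = GenH.tau

theorem abs_epsilon_add_le_wlenH (ε : H →* Multiplicative ℤ)
    (hεx : ε Hx = Multiplicative.ofAdd 1) (hεy : ε Hy = Multiplicative.ofAdd 1)
    (hεt : ε Ht = 1) (hετ : ε Htau = 1) (w : Word GenH) :
    |Multiplicative.toAdd (ε (evalH w))| + 2 * tauCount w ≤ (wlenH w : ℤ) := by
  unfold Hx at hεx
  unfold Hy at hεy
  unfold Ht at hεt
  unfold Htau at hετ
  induction w with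
  | nil => simp [evalH, evalWith_nil, tauCount, wlenH]
  | cons p w ih =>
    have hlen : wlenH (p :: w) = wtH p + wlenH w := by simp [wlenH]
    rw [hlen, evalH, evalWith_cons, ← evalH, map_mul, toAdd_mul]
    rw [tauCount] at ih ⊢
    obtain ⟨_ | _ | _ | _, _ | _⟩ := p <;>
      simp [wtH, hεx, hεy, hεt, hετ] <;> grind

theorem phi_evalH_snd (φ : H →* V) (hφx : φ Hx = 1) (hφy : φ Hy = 1) (hφt : φ Ht = vt)
    (hφτ : φ Htau = vtau) (w : Word GenH) :
    (Multiplicative.toAdd (φ (evalH w))).2 = (tauCount w : ZMod 2) := by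
  unfold Hx at hφx
  unfold Hy at hφy
  unfold Ht at hφt
  unfold Htau at hφτ
  induction w with
  | nil => simp [evalH, evalWith_nil, tauCount]
  | cons p w ih =>
    rw [evalH, evalWith_cons, ← evalH, map_mul, toAdd_mul, Prod.snd_add, ih]
    obtain ⟨_ | _ | _ | _, _ | _⟩ := p <;>
      simp [tauCount, hφx, hφy, hφt, hφτ, vt, vtau, add_comm]

theorem evalH_mem_closure {w : Word GenH} (hw : tauCount w = 0) :
    evalH w ∈ Subgroup.closure {Hx, Hy, Ht} := by
  rw [evalH, evalWith]
  refine Subgroup.list_prod_mem _ ?_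
  simp only [List.mem_map, forall_exists_index, and_imp, forall_apply_eq_imp_iff₂]
  intro p hp
  have hgen : (PresentedGroup.of p.1 : H) ∈ Subgroup.closure {Hx, Hy, Ht} := by
    have hne : p.1 ≠ GenH.tau := by simpa using List.countP_eq_zero.mp hw p hp
    apply Subgroup.subset_closure
    obtain ⟨_ | _ | _ | _, _⟩ := p <;> simp_all [Hx, Hy, Ht]
  split
  · exact hgen
  · exact inv_mem hgen

end NS

open NS in
/-- If `h ∈ H` lies in the kernel `N` of the natural map `H → V` onto the Klein
four-group but not in the subgroup generated by `x`, `y` and `t`, then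
`ℓ(h) ≥ |ε(h)| + 4`. -/
theorem ell_ge_abs_epsilon_add_four
    (φ : H →* V) (hφx : φ Hx = 1) (hφy : φ Hy = 1) (hφt : φ Ht = vt) (hφτ : φ Htau = vtau)
    (ε : H →* Multiplicative ℤ)
    (hεx : ε Hx = Multiplicative.ofAdd 1) (hεy : ε Hy = Multiplicative.ofAdd 1)
    (hεt : ε Ht = 1) (hετ : ε Htau = 1)
    (h : H) (hh : h ∈ MonoidHom.ker φ) (hnot : h ∉ Subgroup.closure {Hx, Hy, Ht}) :
    |Multiplicative.toAdd (ε h)| + 4 ≤ (ellH h : ℤ) := by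
  obtain ⟨w, rfl, hw⟩ := exists_word_wlenH_eq_ellH h
  rw [← hw]
  have hlen := abs_epsilon_add_le_wlenH ε hεx hεy hεt hετ w
  have hpos : tauCount w ≠ 0 := fun h0 => hnot (evalH_mem_closure h0)
  have heven : (tauCount w : ZMod 2) = 0 := by
    rw [← phi_evalH_snd φ hφx hφy hφt hφτ w, MonoidHom.mem_ker.mp hh]
    rfl
  rw [ZMod.natCast_eq_zero_iff] at heven
  have htwo := Nat.le_of_dvd (Nat.pos_of_ne_zero hpos) heven
  omega
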